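/- arXiv:2012.14886 — 8 statements merged into one kernel-verified Lean document; each statement's English description precedes it below -/
import Mathlib

section
/- For any c1, c2, e1, e2 ∈ ℝ and any α ≥ 0, the two-player link-formation game has at least one pure-strategy Nash equilibrium: there exist g1, g2 ∈ {0,1} such that g1 = 1 exactly when c1 + α·g2 ≥ e1 and g2 = 1 exactly when c2 + α·g1 ≥ e2. -/
/-- Numerical value of a binary action. -/
def actVal (g : Bool) : ℝ := if g then 1 else 0

/-- `(g1, g2)` is a pure-strategy Nash equilibrium of the two-player
link-formation game with payoff indices `c1, c2`, interaction `α`, and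
shocks `e1, e2`: player `i` plays 1 exactly when `cᵢ + α·g₋ᵢ ≥ eᵢ`. -/
def IsNashEq (c1 c2 α e1 e2 : ℝ) (g1 g2 : Bool) : Prop :=
  (g1 = true ↔ c1 + α * actVal g2 ≥ e1) ∧ (g2 = true ↔ c2 + α * actVal g1 ≥ e2)

/-- For `α ≥ 0`, the two-player link-formation game always has at least one
pure-strategy Nash equilibrium. -/
theorem exists_pure_nash (c1 c2 e1 e2 α : ℝ) (hα : 0 ≤ α) :
    ∃ g1 g2 : Bool, IsNashEq c1 c2 α e1 e2 g1 g2 := by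
  simp only [IsNashEq, actVal, Bool.exists_bool]
  by_cases h1 : e1 ≤ c1
  · by_cases h2 : e2 ≤ c2 + α <;> grind
  · by_cases h2 : e2 ≤ c2
    · by_cases h3 : e1 ≤ c1 + α <;> grind
    · grind
end

section
/- Let E be a finite-dimensional real inner product space, let f : ℝ × E → ℝ be twice continuously differentiable, and let c : ℝ → E be differentiable with ∂_E f(ρ, c(ρ)) = 0 for every ρ ∈ ℝ. Fix ρ and suppose the Hessian block M = ∂²_{EE} f(ρ, c(ρ)), viewed as a linear map E → E, is invertible. Then c′(ρ) = −M^{-1}( ∂²_{Eρ} f(ρ, c(ρ)) ), and the concentrated function g(ρ) = f(ρ, c(ρ)) is twice differentiable at ρ with g″(ρ) = ∂²_{ρρ} f(ρ, c(ρ)) − ⟨ ∂²_{Eρ} f(ρ, c(ρ)), M^{-1}( ∂²_{Eρ} f(ρ, c(ρ)) ) ⟩. -/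
open RealInnerProductSpace

/-- The gradient of `f : ℝ × E → ℝ` with respect to its `E`-argument, obtained
from the partial Fréchet derivative via the Riesz isomorphism. -/
noncomputable def Egrad {E : Type*} [NormedAddCommGroup E] [InnerProductSpace ℝ E]
    [CompleteSpace E] (f : ℝ × E → ℝ) (p : ℝ × E) : E :=
  (InnerProductSpace.toDual ℝ E).symm
    ((fderiv ℝ f p).comp (ContinuousLinearMap.inr ℝ ℝ E))

/-- The partial gradient represents the `E`-part of the Fréchet derivative. -/
theorem inner_Egrad {E : Type*} [NormedAddCommGroup E] [InnerProductSpace ℝ E]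
    [CompleteSpace E] (f : ℝ × E → ℝ) (p : ℝ × E) (y : E) :
    ⟪Egrad f p, y⟫ = fderiv ℝ f p (0, y) := by
  simp [Egrad]

/-- The partial gradient of a `C²` function is differentiable. -/
theorem differentiable_Egrad {E : Type*} [NormedAddCommGroup E] [InnerProductSpace ℝ E]
    [CompleteSpace E] {f : ℝ × E → ℝ} (hf : ContDiff ℝ 2 f) :
    Differentiable ℝ (Egrad f) := by
  have hdf : Differentiable ℝ (fderiv ℝ f) :=
    (hf.fderiv_right (m := 1) (by norm_num)).differentiable (by norm_num)
  exact (InnerProductSpace.toDual ℝ E).symm.toContinuousLinearEquiv.differentiable.comp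
    (hdf.clm_comp (differentiable_const _))

/-- The derivative of the partial gradient represents the second Fréchet derivative. -/
theorem inner_fderiv_Egrad {E : Type*} [NormedAddCommGroup E] [InnerProductSpace ℝ E]
    [CompleteSpace E] {f : ℝ × E → ℝ} (hf : ContDiff ℝ 2 f) (p w : ℝ × E) (y : E) :
    ⟪fderiv ℝ (Egrad f) p w, y⟫ = fderiv ℝ (fderiv ℝ f) p w (0, y) := by
  have hdf : Differentiable ℝ (fderiv ℝ f) :=
    (hf.fderiv_right (m := 1) (by norm_num)).differentiable (by norm_num)
  have h₁ := (differentiable_Egrad hf p).hasFDerivAt.inner ℝ (hasFDerivAt_const y p)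
  have h₂ := (hdf p).hasFDerivAt.clm_apply (hasFDerivAt_const ((0, y) : ℝ × E) p)
  simp only [inner_Egrad] at h₁
  simpa using DFunLike.congr_fun (h₁.unique h₂) w

/-- Second-order concentrated-derivative formula: if `∂__E f (ρ, c ρ) = 0` for
all `ρ` and the Hessian block `M = ∂²__{EE} f (ρ, c ρ)` is invertible (with
inverse `Minv`), then `c′(ρ) = −M⁻¹(∂²__{Eρ} f (ρ, c ρ))` and the concentrated
function `g(ρ) = f (ρ, c ρ)` is twice differentiable at `ρ` with
`g″(ρ) = ∂²__{ρρ} f (ρ, c ρ) − ⟪∂²__{Eρ} f, M⁻¹ (∂²__{Eρ} f)⟫`. -/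
theorem concentrated_second_deriv {E : Type*} [NormedAddCommGroup E]
    [InnerProductSpace ℝ E] [FiniteDimensional ℝ E]
    (f : ℝ × E → ℝ) (hf : ContDiff ℝ 2 f)
    (c : ℝ → E) (hc : Differentiable ℝ c)
    (hFOC : ∀ r : ℝ,
      (fderiv ℝ f (r, c r)).comp (ContinuousLinearMap.inr ℝ ℝ E) = 0)
    (ρ : ℝ)
    (M : E →L[ℝ] E) (hM : M = fderiv ℝ (fun x => Egrad f (ρ, x)) (c ρ))
    (Minv : E →L[ℝ] E) (hMinv1 : ∀ y, M (Minv y) = y) (hMinv2 : ∀ y, Minv (M y) = y)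
    (v : E) (hv : v = deriv (fun r => Egrad f (r, c ρ)) ρ) :
    deriv c ρ = -(Minv v) ∧
    HasDerivAt (deriv (fun r => f (r, c r)))
      (deriv (fun r => deriv (fun s => f (s, c ρ)) r) ρ - ⟪v, Minv v⟫) ρ := by
  have hdf : Differentiable ℝ (fderiv ℝ f) :=
    (hf.fderiv_right (m := 1) (by norm_num)).differentiable (by norm_num)
  have hf' : Differentiable ℝ f := hf.differentiable (by norm_num)
  have hline (x : E) (r : ℝ) : HasDerivAt (fun s : ℝ => (s, x)) ((1, 0) : ℝ × E) r :=
    (hasDerivAt_id r).prodMk (hasDerivAt_const r x)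
  have hcurve (r : ℝ) : HasDerivAt (fun s => (s, c s)) ((1, deriv c r) : ℝ × E) r :=
    (hasDerivAt_id r).prodMk (hc r).hasDerivAt
  have hG := (differentiable_Egrad hf (ρ, c ρ)).hasFDerivAt
  have hMG (y : E) : M y = fderiv ℝ (Egrad f) (ρ, c ρ) (0, y) := by
    have h := (hG.comp (c ρ) (hasFDerivAt_prodMk_right ρ (c ρ))).fderiv
    rw [Function.comp_def] at h
    simp [hM, h]
  have hvG : v = fderiv ℝ (Egrad f) (ρ, c ρ) (1, 0) := by
    rw [hv]
    exact (hG.comp_hasDerivAt ρ (hline (c ρ) ρ)).deriv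
  have hsplit : ((1, deriv c ρ) : ℝ × E) = (1, 0) + (0, deriv c ρ) := by simp
  have hzero : v + M (deriv c ρ) = 0 := by
    have hconst : Egrad f ∘ (fun r => (r, c r)) = fun _ => 0 := by
      funext r
      simp [Egrad, hFOC r]
    have h := hG.comp_hasDerivAt ρ (hcurve ρ)
    rw [hconst] at h
    rw [hvG, hMG, ← map_add, ← hsplit]
    exact h.unique (hasDerivAt_const ρ 0)
  have hc' : deriv c ρ = -(Minv v) := by
    rw [← hMinv2 (deriv c ρ), eq_neg_of_add_eq_zero_right hzero, map_neg]
  refine ⟨hc', ?_⟩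
  have hg' : deriv (fun r => f (r, c r)) = fun r => fderiv ℝ f (r, c r) (1, 0) := by
    funext r
    have hE : fderiv ℝ f (r, c r) (0, deriv c r) = 0 := by
      simpa using DFunLike.congr_fun (hFOC r) (deriv c r)
    have hadd : ((1, deriv c r) : ℝ × E) = (1, 0) + (0, deriv c r) := by simp
    have h := ((hf' (r, c r)).hasFDerivAt.comp_hasDerivAt r (hcurve r)).deriv
    rwa [hadd, map_add, hE, add_zero] at h
  have hpartial : (fun r => deriv (fun s => f (s, c ρ)) r) =
      fun r => fderiv ℝ f (r, c ρ) (1, 0) := by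
    funext r
    exact ((hf' (r, c ρ)).hasFDerivAt.comp_hasDerivAt r (hline (c ρ) r)).deriv
  have happly := (hdf (ρ, c ρ)).hasFDerivAt.clm_apply
    (hasFDerivAt_const ((1, 0) : ℝ × E) (ρ, c ρ))
  have hρρ : deriv (fun r => fderiv ℝ f (r, c ρ) (1, 0)) ρ =
      fderiv ℝ (fderiv ℝ f) (ρ, c ρ) (1, 0) (1, 0) := by
    simpa [Function.comp_def] using (happly.comp_hasDerivAt ρ (hline (c ρ) ρ)).deriv
  have hsymm : fderiv ℝ (fderiv ℝ f) (ρ, c ρ) (0, deriv c ρ) (1, 0) = -⟪v, Minv v⟫ := by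
    rw [(hf.contDiffAt.isSymmSndFDerivAt (by simp)).eq, ← inner_fderiv_Egrad hf, ← hvG, hc',
      inner_neg_right]
  rw [hg', hpartial, hρρ, sub_eq_add_neg, ← hsymm, ← add_apply, ← map_add,
    ← hsplit]
  simpa [Function.comp_def] using happly.comp_hasDerivAt ρ (hcurve ρ)
end

section
/- Consider the three-group piecewise-constant sequence of length n with break points t1 < t2 and group values a1, a2, a3, and let S denote its binary-segmentation objective. Then for every integer m with 1 ≤ m < t1, S(m) − S(t1) = ( (t1 − m) / ( n·(1 − m/n)·(1 − t1/n) ) ) · [ (1 − t1/n)·(a1 − a2) + (1 − t2/n)·(a2 − a3) ]², and in particular S(m) − S(t1) ≥ 0. -/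
open Finset

/-- Mean of the segment `x_i, …, x_j`. -/
noncomputable def segMean (x : ℕ → ℝ) (i j : ℕ) : ℝ :=
  ((j : ℝ) - (i : ℝ) + 1)⁻¹ * ∑ l ∈ Finset.Icc i j, x l

/-- Sum of squared deviations of the segment `x_i, …, x_j` from its mean. -/
noncomputable def segSS (x : ℕ → ℝ) (i j : ℕ) : ℝ :=
  ∑ l ∈ Finset.Icc i j, (x l - segMean x i j) ^ 2

/-- Binary-segmentation objective splitting the length-`n` sequence at `κ`. -/
noncomputable def bsObj (n : ℕ) (x : ℕ → ℝ) (κ : ℕ) : ℝ :=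
  (n : ℝ)⁻¹ * (segSS x 1 κ + segSS x (κ + 1) n)

/-- The three-group piecewise-constant sequence with break points `t1 < t2`
and group values `a1, a2, a3`. -/
def threeGroup (t1 t2 : ℕ) (a1 a2 a3 : ℝ) (l : ℕ) : ℝ :=
  if l ≤ t1 then a1 else if l ≤ t2 then a2 else a3

/-- Sum of squared deviations as the sum of squares minus the squared sum over the length. -/
lemma segSS_succ_eq (x : ℕ → ℝ) {i j : ℕ} (hij : i < j) :
    segSS x (i + 1) j =
      ∑ l ∈ Ioc i j, x l ^ 2 - (∑ l ∈ Ioc i j, x l) ^ 2 / ((j : ℝ) - i) := by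
  have hlen : (j : ℝ) - i ≠ 0 := sub_ne_zero.mpr (by exact_mod_cast hij.ne')
  have hIcc : Icc (i + 1) j = Ioc i j := by ext; simp
  have hcard : ((Ioc i j).card : ℝ) = j - i := by
    rw [Nat.card_Ioc, Nat.cast_sub hij.le]
  have hmean : segMean x (i + 1) j = (∑ l ∈ Ioc i j, x l) / ((j : ℝ) - i) := by
    rw [segMean, hIcc, div_eq_inv_mul]
    push_cast
    ring_nf
  simp only [segSS, hIcc, sub_sq, sum_add_distrib, sum_sub_distrib, ← sum_mul, ← mul_sum,
    sum_const, nsmul_eq_mul, hcard, hmean]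
  field_simp
  ring

lemma sum_Ioc_eq_mul_of_const {f : ℕ → ℝ} {c : ℝ} {i j : ℕ} (hij : i ≤ j)
    (hf : ∀ l ∈ Ioc i j, f l = c) : ∑ l ∈ Ioc i j, f l = ((j : ℝ) - i) * c := by
  rw [sum_congr rfl hf, sum_const, nsmul_eq_mul, Nat.card_Ioc, Nat.cast_sub hij]

/-- A segment on which the sequence is constant has no sum of squared deviations. -/
lemma segSS_succ_eq_zero_of_const {x : ℕ → ℝ} {c : ℝ} {i j : ℕ} (hij : i < j)
    (hx : ∀ l ∈ Ioc i j, x l = c) : segSS x (i + 1) j = 0 := by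
  have hlen : (j : ℝ) - i ≠ 0 := sub_ne_zero.mpr (by exact_mod_cast hij.ne')
  rw [segSS_succ_eq x hij, sum_Ioc_eq_mul_of_const hij.le hx,
    sum_Ioc_eq_mul_of_const (c := c ^ 2) hij.le fun l hl => by rw [hx l hl]]
  field_simp
  ring

/-- Sums of a function of the three-group sequence from a point at or before the first break. -/
lemma sum_Ioc_threeGroup (f : ℝ → ℝ) {n t1 t2 m : ℕ} (a1 a2 a3 : ℝ)
    (hm : m ≤ t1) (h12 : t1 ≤ t2) (h2n : t2 ≤ n) :
    ∑ l ∈ Ioc m n, f (threeGroup t1 t2 a1 a2 a3 l) =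
      ((t1 : ℝ) - m) * f a1 + ((t2 : ℝ) - t1) * f a2 + ((n : ℝ) - t2) * f a3 := by
  rw [← sum_Ioc_consecutive _ (hm.trans h12) h2n, ← sum_Ioc_consecutive _ hm h12]
  congr 1
  · congr 1
    · refine sum_Ioc_eq_mul_of_const hm fun l hl => ?_
      rw [threeGroup, if_pos (mem_Ioc.mp hl).2]
    · refine sum_Ioc_eq_mul_of_const h12 fun l hl => ?_
      rw [threeGroup, if_neg (mem_Ioc.mp hl).1.not_ge, if_pos (mem_Ioc.mp hl).2]
  · refine sum_Ioc_eq_mul_of_const h2n fun l hl => ?_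
    have h2 := (mem_Ioc.mp hl).1
    rw [threeGroup, if_neg (h12.trans_lt h2).not_ge, if_neg h2.not_ge]

/-- The objective at a split point at or before the first break. -/
lemma bsObj_threeGroup {n t1 t2 m : ℕ} (a1 a2 a3 : ℝ)
    (hm1 : 1 ≤ m) (hm : m ≤ t1) (h12 : t1 < t2) (h2n : t2 < n) :
    bsObj n (threeGroup t1 t2 a1 a2 a3) m =
      (n : ℝ)⁻¹ * (((t1 : ℝ) - m) * a1 ^ 2 + ((t2 : ℝ) - t1) * a2 ^ 2 + ((n : ℝ) - t2) * a3 ^ 2 -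
        (((t1 : ℝ) - m) * a1 + ((t2 : ℝ) - t1) * a2 + ((n : ℝ) - t2) * a3) ^ 2 /
          ((n : ℝ) - m)) := by
  have hleft : segSS (threeGroup t1 t2 a1 a2 a3) 1 m = 0 :=
    segSS_succ_eq_zero_of_const (i := 0) (c := a1) hm1 fun l hl => by
      rw [threeGroup, if_pos ((mem_Ioc.mp hl).2.trans hm)]
  rw [bsObj, hleft, zero_add, segSS_succ_eq _ (hm.trans_lt (h12.trans h2n)),
    sum_Ioc_threeGroup (fun y => y ^ 2) a1 a2 a3 hm h12.le h2n.le,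
    sum_Ioc_threeGroup (fun y => y) a1 a2 a3 hm h12.le h2n.le]

/-- For a split point `m` strictly left of the first break point `t1`, the
binary-segmentation objective satisfies the exact identity of the proof of
Theorem 4, and in particular `S(m) − S(t1) ≥ 0`. -/
theorem bs_left_of_first_break (n t1 t2 : ℕ) (a1 a2 a3 : ℝ)
    (ht1 : 1 ≤ t1) (h12 : t1 < t2) (h2n : t2 < n)
    (m : ℕ) (hm1 : 1 ≤ m) (hmt : m < t1) :
    bsObj n (threeGroup t1 t2 a1 a2 a3) m - bsObj n (threeGroup t1 t2 a1 a2 a3) t1 =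
      (((t1 : ℝ) - (m : ℝ)) /
          ((n : ℝ) * (1 - (m : ℝ) / (n : ℝ)) * (1 - (t1 : ℝ) / (n : ℝ)))) *
        ((1 - (t1 : ℝ) / (n : ℝ)) * (a1 - a2) +
          (1 - (t2 : ℝ) / (n : ℝ)) * (a2 - a3)) ^ 2 ∧
    0 ≤ bsObj n (threeGroup t1 t2 a1 a2 a3) m -
        bsObj n (threeGroup t1 t2 a1 a2 a3) t1 := by
  have hmt' : (m : ℝ) < t1 := by exact_mod_cast hmt
  have htn : (t1 : ℝ) < n := by exact_mod_cast h12.trans h2n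
  have hn : (0 : ℝ) < n := (Nat.cast_nonneg t1).trans_lt htn
  have hqm : 0 < 1 - (m : ℝ) / n := sub_pos.mpr ((div_lt_one hn).mpr (hmt'.trans htn))
  have hqt : 0 < 1 - (t1 : ℝ) / n := sub_pos.mpr ((div_lt_one hn).mpr htn)
  refine and_iff_left_of_imp (fun h => ?_) |>.mpr ?_
  · rw [h]
    have := sub_pos.mpr hmt'
    positivity
  · rw [bsObj_threeGroup a1 a2 a3 hm1 hmt.le h12 h2n,
      bsObj_threeGroup a1 a2 a3 ht1 le_rfl h12 h2n]
    have hnm : (n : ℝ) - m ≠ 0 := (sub_pos.mpr (hmt'.trans htn)).ne'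
    have hnt : (n : ℝ) - t1 ≠ 0 := (sub_pos.mpr htn).ne'
    field_simp
    ring
end

section
/- Consider the three-group piecewise-constant sequence of length n with break points t1 < t2 and group values a1, a2, a3, and let S denote its binary-segmentation objective. Then for every integer m with t1 < m ≤ t2 (and m < n), S(m) − S(t1) = ( (m − t1)/n ) · [ (t1/m)·(a1 − a2)² − ( (n − t2)² / ( (n − m)·(n − t1) ) )·(a2 − a3)² ]. -/
open Finset

theorem sum_Icc_succ_of_two_valued {f : ℕ → ℝ} {p k q : ℕ} {a b : ℝ}
    (hpk : p ≤ k) (hkq : k ≤ q)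
    (ha : ∀ l, p < l → l ≤ k → f l = a) (hb : ∀ l, k < l → l ≤ q → f l = b) :
    ∑ l ∈ Finset.Icc (p + 1) q, f l = ((k : ℝ) - p) * a + ((q : ℝ) - k) * b := by
  have hsplit : Finset.Icc (p + 1) q = Finset.Ioc p k ∪ Finset.Ioc k q := by
    ext l
    simp only [Finset.mem_Icc, Finset.mem_union, Finset.mem_Ioc]
    omega
  have hdisj : Disjoint (Finset.Ioc p k) (Finset.Ioc k q) := by
    refine Finset.disjoint_left.2 fun l hl hl' => ?_
    simp only [Finset.mem_Ioc] at hl hl'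
    omega
  rw [hsplit, Finset.sum_union hdisj,
    Finset.sum_congr rfl fun l hl => ha l (Finset.mem_Ioc.1 hl).1 (Finset.mem_Ioc.1 hl).2,
    Finset.sum_congr rfl fun l hl => hb l (Finset.mem_Ioc.1 hl).1 (Finset.mem_Ioc.1 hl).2]
  simp [Nat.cast_sub hpk, Nat.cast_sub hkq]

theorem segSS_succ_of_two_valued {x : ℕ → ℝ} {p k q : ℕ} {a b : ℝ}
    (hpk : p ≤ k) (hkq : k ≤ q) (hpq : p < q)
    (ha : ∀ l, p < l → l ≤ k → x l = a) (hb : ∀ l, k < l → l ≤ q → x l = b) :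
    segSS x (p + 1) q = ((k : ℝ) - p) * ((q : ℝ) - k) / ((q : ℝ) - p) * (a - b) ^ 2 := by
  have hne : (q : ℝ) - p ≠ 0 := (sub_pos.2 (Nat.cast_lt.2 hpq)).ne'
  have hmean : segMean x (p + 1) q =
      (((k : ℝ) - p) * a + ((q : ℝ) - k) * b) / ((q : ℝ) - p) := by
    rw [segMean, sum_Icc_succ_of_two_valued hpk hkq ha hb, div_eq_inv_mul]
    congr 2
    push_cast
    ring
  rw [segSS, sum_Icc_succ_of_two_valued (a := (a - segMean x (p + 1) q) ^ 2)
    (b := (b - segMean x (p + 1) q) ^ 2) hpk hkq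
    (fun l h h' => by rw [ha l h h']) (fun l h h' => by rw [hb l h h']), hmean]
  field_simp
  ring

/-- For a split point `m` with `t1 < m ≤ t2` (and `m < n`), the exact identity
for `S(m) − S(t1)` from the proof of Theorem 4. -/
theorem bs_between_breaks (n t1 t2 : ℕ) (a1 a2 a3 : ℝ)
    (ht1 : 1 ≤ t1) (h12 : t1 < t2) (h2n : t2 < n)
    (m : ℕ) (hmt1 : t1 < m) (hmt2 : m ≤ t2) (hmn : m < n) :
    bsObj n (threeGroup t1 t2 a1 a2 a3) m - bsObj n (threeGroup t1 t2 a1 a2 a3) t1 =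
      (((m : ℝ) - (t1 : ℝ)) / (n : ℝ)) *
        (((t1 : ℝ) / (m : ℝ)) * (a1 - a2) ^ 2 -
          (((n : ℝ) - (t2 : ℝ)) ^ 2 /
            (((n : ℝ) - (m : ℝ)) * ((n : ℝ) - (t1 : ℝ)))) * (a2 - a3) ^ 2) := by
  have hleft : ∀ l, 0 < l → l ≤ t1 → threeGroup t1 t2 a1 a2 a3 l = a1 :=
    fun l _ h => if_pos h
  have hmid : ∀ l, t1 < l → l ≤ t2 → threeGroup t1 t2 a1 a2 a3 l = a2 := fun l h h' => by
    rw [threeGroup, if_neg h.not_ge, if_pos h']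
  have hright : ∀ l, t2 < l → l ≤ n → threeGroup t1 t2 a1 a2 a3 l = a3 := fun l h _ => by
    rw [threeGroup, if_neg (h12.trans h).not_ge, if_neg h.not_ge]
  have e1 := segSS_succ_of_two_valued (Nat.zero_le t1) hmt1.le (by omega) hleft
    fun l h h' => hmid l h (h'.trans hmt2)
  have e2 := segSS_succ_of_two_valued hmt2 h2n.le hmn
    (fun l h h' => hmid l (hmt1.trans h) h') hright
  have e3 := segSS_succ_of_two_valued (b := a1) (Nat.zero_le t1) le_rfl ht1 hleft
    fun l h h' => absurd h' h.not_ge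
  have e4 := segSS_succ_of_two_valued h12.le h2n.le (h12.trans h2n) hmid hright
  rw [zero_add] at e1 e3
  rw [bsObj, bsObj, e1, e2, e3, e4]
  have hm : (m : ℝ) ≠ 0 := Nat.cast_ne_zero.2 (by omega)
  have hn : (n : ℝ) ≠ 0 := Nat.cast_ne_zero.2 (by omega)
  have hnm : (n : ℝ) - m ≠ 0 := (sub_pos.2 (Nat.cast_lt.2 hmn)).ne'
  have hnt : (n : ℝ) - t1 ≠ 0 := (sub_pos.2 (Nat.cast_lt.2 (h12.trans h2n))).ne'
  simp only [Nat.cast_zero, sub_zero, sub_self, mul_zero, zero_div, zero_mul, zero_add]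
  field_simp
  ring
end

section
/- Consider the three-group piecewise-constant sequence of length n with break points t1 < t2 and group values a1, a2, a3, and let S denote its binary-segmentation objective. Then S(t2) − S(t1) = ( (t2 − t1)/n ) · [ (t1/t2)·(a1 − a2)² − ( (n − t2)/(n − t1) )·(a2 − a3)² ]. -/
open Finset

/-- A sum over a segment of a function of a two-valued sequence. -/
theorem sum_Icc_comp_of_two_values {x : ℕ → ℝ} {i m j : ℕ} {a b : ℝ} (f : ℝ → ℝ)
    (him : i ≤ m + 1) (hmj : m ≤ j) (ha : ∀ l, i ≤ l → l ≤ m → x l = a)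
    (hb : ∀ l, m < l → l ≤ j → x l = b) :
    ∑ l ∈ Finset.Icc i j, f (x l) =
      ((m : ℝ) - i + 1) * f a + ((j : ℝ) - m) * f b := by
  have hunion : Finset.Icc i j = Finset.Icc i m ∪ Finset.Icc (m + 1) j := by
    ext l
    simp only [Finset.mem_union, Finset.mem_Icc]
    omega
  have hdisj : Disjoint (Finset.Icc i m) (Finset.Icc (m + 1) j) := by
    rw [Finset.disjoint_left]
    intro l h1 h2
    rw [Finset.mem_Icc] at h1 h2
    omega
  have hleft : ∑ l ∈ Finset.Icc i m, f (x l) = ∑ _l ∈ Finset.Icc i m, f a :=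
    Finset.sum_congr rfl fun l hl => by
      rw [Finset.mem_Icc] at hl
      rw [ha l hl.1 hl.2]
  have hright : ∑ l ∈ Finset.Icc (m + 1) j, f (x l) = ∑ _l ∈ Finset.Icc (m + 1) j, f b :=
    Finset.sum_congr rfl fun l hl => by
      rw [Finset.mem_Icc] at hl
      rw [hb l hl.1 hl.2]
  rw [hunion, Finset.sum_union hdisj, hleft, hright]
  simp only [Finset.sum_const, Nat.card_Icc, nsmul_eq_mul]
  rw [Nat.cast_sub him, Nat.cast_sub (by omega : m + 1 ≤ j + 1)]
  push_cast
  ring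

/-- The sum of squares of a segment on which the sequence takes the value `a` up to `m` and
the value `b` afterwards. -/
theorem segSS_of_two_values {x : ℕ → ℝ} {i m j : ℕ} {a b : ℝ} (hij : i ≤ j)
    (him : i ≤ m + 1) (hmj : m ≤ j) (ha : ∀ l, i ≤ l → l ≤ m → x l = a)
    (hb : ∀ l, m < l → l ≤ j → x l = b) :
    segSS x i j =
      ((m : ℝ) - i + 1) * ((j : ℝ) - m) / ((j : ℝ) - i + 1) * (a - b) ^ 2 := by
  have hne : (j : ℝ) - i + 1 ≠ 0 := by
    have : (i : ℝ) ≤ j := by exact_mod_cast hij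
    linarith
  have hsum := sum_Icc_comp_of_two_values (fun y => y) him hmj ha hb
  have hmean : segMean x i j =
      (((m : ℝ) - i + 1) * a + ((j : ℝ) - m) * b) / ((j : ℝ) - i + 1) := by
    rw [segMean, hsum, inv_mul_eq_div]
  rw [segSS, sum_Icc_comp_of_two_values (fun y => (y - segMean x i j) ^ 2) him hmj ha hb, hmean]
  field_simp
  ring

/-- Exact identity for `S(t2) − S(t1)` for the three-group piecewise-constant
sequence (proof of Theorem 4). -/
theorem bs_diff_at_breaks (n t1 t2 : ℕ) (a1 a2 a3 : ℝ)
    (ht1 : 1 ≤ t1) (h12 : t1 < t2) (h2n : t2 < n) :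
    bsObj n (threeGroup t1 t2 a1 a2 a3) t2 - bsObj n (threeGroup t1 t2 a1 a2 a3) t1 =
      (((t2 : ℝ) - (t1 : ℝ)) / (n : ℝ)) *
        (((t1 : ℝ) / (t2 : ℝ)) * (a1 - a2) ^ 2 -
          (((n : ℝ) - (t2 : ℝ)) / ((n : ℝ) - (t1 : ℝ))) * (a2 - a3) ^ 2) := by
  have hleft : ∀ l, l ≤ t1 → threeGroup t1 t2 a1 a2 a3 l = a1 := fun l h => by
    simp [threeGroup, h]
  have hmid : ∀ l, t1 < l → l ≤ t2 → threeGroup t1 t2 a1 a2 a3 l = a2 := fun l h h' => by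
    simp [threeGroup, h.not_ge, h']
  have hright : ∀ l, t2 < l → threeGroup t1 t2 a1 a2 a3 l = a3 := fun l h => by
    simp [threeGroup, h.not_ge, (h12.trans h).not_ge]
  have hfirst : segSS (threeGroup t1 t2 a1 a2 a3) 1 t1 = _ :=
    segSS_of_two_values (a := a1) (b := a1) ht1 (by omega) le_rfl
      (fun l _ h => hleft l h) (fun l h h' => absurd h' h.not_ge)
  have hlast : segSS (threeGroup t1 t2 a1 a2 a3) (t2 + 1) n = _ :=
    segSS_of_two_values (a := a3) (b := a3) h2n (by omega) le_rfl
      (fun l h _ => hright l h) (fun l h h' => absurd h' h.not_ge)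
  have hfirst_two : segSS (threeGroup t1 t2 a1 a2 a3) 1 t2 = _ :=
    segSS_of_two_values (ht1.trans h12.le) (by omega) h12.le (fun l _ h => hleft l h) hmid
  have hlast_two : segSS (threeGroup t1 t2 a1 a2 a3) (t1 + 1) n = _ :=
    segSS_of_two_values (h12.trans h2n) (by omega) h2n.le hmid (fun l h _ => hright l h)
  have hn : (n : ℝ) ≠ 0 := by
    have : n ≠ 0 := by omega
    exact_mod_cast this
  have ht2 : (t2 : ℝ) ≠ 0 := by
    have : t2 ≠ 0 := by omega
    exact_mod_cast this
  have hnt : (n : ℝ) - t1 ≠ 0 := by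
    have : (t1 : ℝ) < n := by exact_mod_cast h12.trans h2n
    linarith
  have hsucc : ∀ y z : ℝ, y - (z + 1) + 1 = y - z := fun y z => by ring
  rw [bsObj, bsObj, hfirst, hlast, hfirst_two, hlast_two]
  push_cast
  simp only [hsucc, sub_self, sub_add_cancel]
  field_simp
  ring
end

section
/- Let n ≥ 2 and let x : {1,…,n} → ℝ be the two-group piecewise-constant sequence with a single break point 1 ≤ t1 < n and distinct group values a1 ≠ a2, i.e., x_l = a1 for l ≤ t1 and x_l = a2 for l > t1. Then t1 is the unique minimizer of the binary-segmentation objective: S(κ) > S(t1) for every integer 1 ≤ κ < n with κ ≠ t1 (and S(t1) = 0). -/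
open Finset

/-- The two-group piecewise-constant sequence with break point `t1` and group
values `a1, a2`. -/
def twoGroup (t1 : ℕ) (a1 a2 : ℝ) (l : ℕ) : ℝ :=
  if l ≤ t1 then a1 else a2

theorem segSS_nonneg (x : ℕ → ℝ) (i j : ℕ) : 0 ≤ segSS x i j :=
  Finset.sum_nonneg fun _ _ => sq_nonneg _

theorem segMean_of_const {x : ℕ → ℝ} {i j : ℕ} {c : ℝ} (hij : i ≤ j)
    (hx : ∀ l ∈ Finset.Icc i j, x l = c) : segMean x i j = c := by
  have hcard : ((Finset.Icc i j).card : ℝ) = (j : ℝ) - i + 1 := by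
    rw [Nat.card_Icc, Nat.cast_sub (by lia)]
    push_cast
    ring
  have hij' : (i : ℝ) ≤ j := by exact_mod_cast hij
  have hne : (j : ℝ) - i + 1 ≠ 0 := by linarith
  rw [segMean, Finset.sum_congr rfl hx, Finset.sum_const, nsmul_eq_mul, hcard,
    inv_mul_cancel_left₀ hne]

theorem segSS_of_const {x : ℕ → ℝ} {i j : ℕ} {c : ℝ} (hij : i ≤ j)
    (hx : ∀ l ∈ Finset.Icc i j, x l = c) : segSS x i j = 0 := by
  rw [segSS, segMean_of_const hij hx]
  exact Finset.sum_eq_zero fun l hl => by simp [hx l hl]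

theorem segSS_pos_of_ne {x : ℕ → ℝ} {i j p q : ℕ} (hp : p ∈ Finset.Icc i j)
    (hq : q ∈ Finset.Icc i j) (hpq : x p ≠ x q) : 0 < segSS x i j := by
  refine (segSS_nonneg x i j).lt_of_ne' fun h => hpq ?_
  rw [segSS, Finset.sum_eq_zero_iff_of_nonneg fun _ _ => sq_nonneg _] at h
  have h₁ := pow_eq_zero_iff two_ne_zero |>.mp (h p hp)
  have h₂ := pow_eq_zero_iff two_ne_zero |>.mp (h q hq)
  linarith

theorem twoGroup_of_le {t l : ℕ} (a b : ℝ) (h : l ≤ t) : twoGroup t a b l = a :=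
  if_pos h

theorem twoGroup_of_lt {t l : ℕ} (a b : ℝ) (h : t < l) : twoGroup t a b l = b :=
  if_neg h.not_ge

/-- Noiseless two-group case: the true break point `t1` is the unique
minimizer of the binary-segmentation objective, with `S(t1) = 0`. -/
theorem bs_two_group_unique_min (n t1 : ℕ) (a1 a2 : ℝ)
    (hn : 2 ≤ n) (ht1 : 1 ≤ t1) (ht1n : t1 < n) (ha : a1 ≠ a2) :
    bsObj n (twoGroup t1 a1 a2) t1 = 0 ∧
    ∀ κ : ℕ, 1 ≤ κ → κ < n → κ ≠ t1 →
      bsObj n (twoGroup t1 a1 a2) t1 < bsObj n (twoGroup t1 a1 a2) κ := by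
  have hzero : bsObj n (twoGroup t1 a1 a2) t1 = 0 := by
    rw [bsObj, segSS_of_const ht1 fun l hl => twoGroup_of_le a1 a2 (Finset.mem_Icc.mp hl).2,
      segSS_of_const ht1n fun l hl => twoGroup_of_lt a1 a2 (Finset.mem_Icc.mp hl).1]
    simp
  refine ⟨hzero, fun κ hκ hκn hne => ?_⟩
  have hne' : twoGroup t1 a1 a2 t1 ≠ twoGroup t1 a1 a2 (t1 + 1) := by
    rwa [twoGroup_of_le a1 a2 le_rfl, twoGroup_of_lt a1 a2 (Nat.lt_succ_self t1)]
  rw [hzero, bsObj]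
  refine mul_pos (inv_pos.mpr (by exact_mod_cast (by lia : 0 < n))) ?_
  rcases hne.lt_or_gt with h | h
  · exact add_pos_of_nonneg_of_pos (segSS_nonneg _ _ _)
      (segSS_pos_of_ne (Finset.mem_Icc.mpr ⟨by lia, by lia⟩)
        (Finset.mem_Icc.mpr ⟨by lia, by lia⟩) hne')
  · exact add_pos_of_pos_of_nonneg
      (segSS_pos_of_ne (Finset.mem_Icc.mpr ⟨by lia, by lia⟩)
        (Finset.mem_Icc.mpr ⟨by lia, by lia⟩) hne') (segSS_nonneg _ _ _)
end

section
/- Consider the three-group piecewise-constant sequence of length n with break points t1 < t2 and strictly increasing group values a1 < a2 < a3, and let S denote its binary-segmentation objective. If S(t1) < S(t2), then t1 is the unique minimizer of S over {1,…,n−1}: S(κ) > S(t1) for every integer 1 ≤ κ < n with κ ≠ t1. -/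
open Finset

theorem segSS_eq (x : ℕ → ℝ) (c : ℝ) {i j : ℕ} (hij : i ≤ j) :
    segSS x i j = ∑ l ∈ Icc i j, (x l - c) ^ 2
      - (∑ l ∈ Icc i j, (x l - c)) ^ 2 / ((j : ℝ) - i + 1) := by
  have hm : (0 : ℝ) < (j : ℝ) - i + 1 := by
    have : (i : ℝ) ≤ j := by exact_mod_cast hij
    linarith
  have hcard : ((#(Icc i j) : ℕ) : ℝ) = (j : ℝ) - i + 1 := by
    rw [Nat.card_Icc, Nat.cast_sub (by omega)]
    push_cast
    ring
  have hsum : ∑ l ∈ Icc i j, (x l - c) = ∑ l ∈ Icc i j, x l - ((j : ℝ) - i + 1) * c := by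
    rw [sum_sub_distrib, sum_const, nsmul_eq_mul, hcard]
  have hmean : segMean x i j = c + (∑ l ∈ Icc i j, (x l - c)) / ((j : ℝ) - i + 1) := by
    rw [hsum, segMean]
    field_simp
    ring
  have hexp (d : ℝ) : ∑ l ∈ Icc i j, (x l - (c + d)) ^ 2 =
      ∑ l ∈ Icc i j, (x l - c) ^ 2 - 2 * d * ∑ l ∈ Icc i j, (x l - c)
        + ((j : ℝ) - i + 1) * d ^ 2 := by
    rw [← hcard, ← nsmul_eq_mul, ← sum_const, mul_sum, ← sum_sub_distrib, ← sum_add_distrib]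
    exact sum_congr rfl fun l _ => by ring
  rw [segSS, hmean, hexp]
  field_simp
  ring

theorem sum_Icc_one_add_sum_Icc (f : ℕ → ℝ) {k n : ℕ} (h : k ≤ n) :
    ∑ l ∈ Icc 1 k, f l + ∑ l ∈ Icc (k + 1) n, f l = ∑ l ∈ Icc 1 n, f l := by
  rw [← sum_union]
  · congr 1
    ext l
    simp only [mem_union, mem_Icc]
    omega
  · rw [disjoint_left]
    intro l
    simp only [mem_Icc]
    omega

/-- The objective in terms of the partial sums centred at an arbitrary `c`. -/
theorem bsObj_eq (x : ℕ → ℝ) (c : ℝ) {n κ : ℕ} (h1 : 1 ≤ κ) (hn : κ < n) :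
    bsObj n x κ = (n : ℝ)⁻¹ * (∑ l ∈ Icc 1 n, (x l - c) ^ 2
      - ((∑ l ∈ Icc 1 κ, (x l - c)) ^ 2 / κ
        + (∑ l ∈ Icc (κ + 1) n, (x l - c)) ^ 2 / ((n : ℝ) - κ))) := by
  have e1 : (κ : ℝ) - (1 : ℕ) + 1 = κ := by push_cast; ring
  have e2 : (n : ℝ) - (κ + 1 : ℕ) + 1 = (n : ℝ) - κ := by push_cast; ring
  rw [bsObj, segSS_eq x c h1, segSS_eq x c (Nat.succ_le_of_lt hn), e1, e2,
    ← sum_Icc_one_add_sum_Icc _ hn.le]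
  ring

theorem bsObj_lt_iff (x : ℕ → ℝ) (c : ℝ) {n κ μ : ℕ} (h1 : 1 ≤ κ) (hn : κ < n)
    (h1' : 1 ≤ μ) (hn' : μ < n) :
    bsObj n x κ < bsObj n x μ ↔
      (∑ l ∈ Icc 1 μ, (x l - c)) ^ 2 / μ
          + (∑ l ∈ Icc (μ + 1) n, (x l - c)) ^ 2 / ((n : ℝ) - μ) <
        (∑ l ∈ Icc 1 κ, (x l - c)) ^ 2 / κ
          + (∑ l ∈ Icc (κ + 1) n, (x l - c)) ^ 2 / ((n : ℝ) - κ) := by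
  have : (0 : ℝ) < (n : ℝ)⁻¹ := inv_pos.2 (by exact_mod_cast (by omega : 0 < n))
  rw [bsObj_eq x c h1 hn, bsObj_eq x c h1' hn', mul_lt_mul_iff_right₀ this, sub_lt_sub_iff_left]

theorem bsObj_lt_of_const_left (x : ℕ → ℝ) (c : ℝ) {n t κ : ℕ} (h1 : 1 ≤ κ) (hκ : κ < t)
    (hn : t < n) (hx : ∀ l ≤ t, x l = c) (hne : ∑ l ∈ Icc 1 n, (x l - c) ≠ 0) :
    bsObj n x t < bsObj n x κ := by
  have hz (m : ℕ) (hm : m ≤ t) : ∑ l ∈ Icc 1 m, (x l - c) = 0 :=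
    sum_eq_zero fun l hl => by rw [hx l ((mem_Icc.1 hl).2.trans hm), sub_self]
  have hr (m : ℕ) (hm : m ≤ t) : ∑ l ∈ Icc (m + 1) n, (x l - c) = ∑ l ∈ Icc 1 n, (x l - c) := by
    rw [← sum_Icc_one_add_sum_Icc (fun l => x l - c) (hm.trans hn.le), hz m hm, zero_add]
  rw [bsObj_lt_iff x c (by omega) hn h1 (by omega), hz κ hκ.le, hz t le_rfl, hr κ hκ.le,
    hr t le_rfl]
  have hκ' : (κ : ℝ) < t := by exact_mod_cast hκ
  have hn' : (t : ℝ) < n := by exact_mod_cast hn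
  have hpos := sq_pos_of_ne_zero hne
  simp only [ne_eq, OfNat.ofNat_ne_zero, not_false_eq_true, zero_pow, zero_div, zero_add]
  exact div_lt_div_of_pos_left hpos (by linarith) (by linarith)

theorem bsObj_le_of_const_right (x : ℕ → ℝ) (c : ℝ) {n t κ : ℕ} (h1 : 1 ≤ t) (hκ : t ≤ κ)
    (hn : κ < n) (hx : ∀ l, t < l → x l = c) :
    bsObj n x t ≤ bsObj n x κ := by
  have hz (m : ℕ) (hm : t ≤ m) : ∑ l ∈ Icc (m + 1) n, (x l - c) = 0 :=
    sum_eq_zero fun l hl => by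
      rw [hx l (hm.trans_lt (Nat.lt_of_succ_le (mem_Icc.1 hl).1)), sub_self]
  have hr (m : ℕ) (hm : t ≤ m) (hmn : m ≤ n) :
      ∑ l ∈ Icc 1 m, (x l - c) = ∑ l ∈ Icc 1 n, (x l - c) := by
    rw [← sum_Icc_one_add_sum_Icc (fun l => x l - c) hmn, hz m hm, add_zero]
  rw [← not_lt, bsObj_lt_iff x c (by omega) hn h1 (by omega), hz κ hκ, hz t le_rfl,
    hr κ hκ hn.le, hr t le_rfl (by omega), not_lt]
  have hκ' : (t : ℝ) ≤ κ := by exact_mod_cast hκ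
  have ht : (0 : ℝ) < t := by exact_mod_cast h1
  simp only [ne_eq, OfNat.ofNat_ne_zero, not_false_eq_true, zero_pow, zero_div, add_zero]
  gcongr

theorem div_add_div_sub_lt {A B n t κ s : ℝ} (hA : 0 ≤ A) (hB : 0 ≤ B) (ht : 0 < t)
    (htκ : t < κ) (hκs : κ < s) (hsn : s < n)
    (h : A / s + B / (n - s) < A / t + B / (n - t)) :
    A / κ + B / (n - κ) < A / t + B / (n - t) := by
  have key (r : ℝ) (h1 : t < r) (h2 : r < n) : A / r + B / (n - r) < A / t + B / (n - t) ↔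
      B * (t * r) < A * ((n - r) * (n - t)) := by
    have hr : 0 < r := by linarith
    have hnr : 0 < n - r := by linarith
    have hnt : 0 < n - t := by linarith
    have hrt : 0 < r - t := by linarith
    have e : A / t + B / (n - t) - (A / r + B / (n - r)) =
        (r - t) * (A * ((n - r) * (n - t)) - B * (t * r)) / (t * r * ((n - r) * (n - t))) := by
      field_simp
      ring
    rw [← sub_pos, e, div_pos_iff_of_pos_right (by positivity), mul_pos_iff_of_pos_left hrt,
      sub_pos]
  rw [key s (by linarith) hsn] at h
  rw [key κ htκ (by linarith)]
  have hnt : 0 ≤ n - t := by linarith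
  calc B * (t * κ) ≤ B * (t * s) := by gcongr
    _ < A * ((n - s) * (n - t)) := h
    _ ≤ A * ((n - κ) * (n - t)) := by gcongr

theorem bsObj_lt_of_const_between (x : ℕ → ℝ) (c : ℝ) {n t s κ : ℕ} (h1 : 1 ≤ t) (htκ : t < κ)
    (hκs : κ < s) (hn : s < n) (hx : ∀ l, t < l → l ≤ s → x l = c)
    (h : bsObj n x t < bsObj n x s) :
    bsObj n x t < bsObj n x κ := by
  have hl (m : ℕ) (h1 : t ≤ m) (h2 : m ≤ s) :
      ∑ l ∈ Icc 1 m, (x l - c) = ∑ l ∈ Icc 1 t, (x l - c) := by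
    rw [← sum_Icc_one_add_sum_Icc (fun l => x l - c) h1, add_eq_left]
    refine sum_eq_zero fun l hl => ?_
    rw [mem_Icc] at hl
    rw [hx l (by omega) (by omega), sub_self]
  have hr (m : ℕ) (h1 : t ≤ m) (h2 : m ≤ s) :
      ∑ l ∈ Icc (m + 1) n, (x l - c) = ∑ l ∈ Icc (t + 1) n, (x l - c) := by
    have e1 := sum_Icc_one_add_sum_Icc (fun l => x l - c) (h2.trans hn.le)
    have e2 := sum_Icc_one_add_sum_Icc (fun l => x l - c) (h1.trans (h2.trans hn.le))
    have e3 := hl m h1 h2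
    linarith
  rw [bsObj_lt_iff x c h1 (by omega) (by omega) (by omega), hl s (by omega) le_rfl,
    hr s (by omega) le_rfl] at h
  rw [bsObj_lt_iff x c h1 (by omega) (by omega) (by omega), hl κ htκ.le hκs.le,
    hr κ htκ.le hκs.le]
  exact div_add_div_sub_lt (sq_nonneg _) (sq_nonneg _) (by exact_mod_cast h1)
    (by exact_mod_cast htκ) (by exact_mod_cast hκs) (by exact_mod_cast hn) h

/-- Noiseless three-group case with strictly increasing group values: if
`S(t1) < S(t2)`, then `t1` is the unique minimizer of the
binary-segmentation objective over `{1, …, n−1}`. -/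
theorem bs_three_group_unique_min (n t1 t2 : ℕ) (a1 a2 a3 : ℝ)
    (ht1 : 1 ≤ t1) (h12 : t1 < t2) (h2n : t2 < n)
    (ha12 : a1 < a2) (ha23 : a2 < a3)
    (hS : bsObj n (threeGroup t1 t2 a1 a2 a3) t1 <
          bsObj n (threeGroup t1 t2 a1 a2 a3) t2) :
    ∀ κ : ℕ, 1 ≤ κ → κ < n → κ ≠ t1 →
      bsObj n (threeGroup t1 t2 a1 a2 a3) t1 <
        bsObj n (threeGroup t1 t2 a1 a2 a3) κ := by
  intro κ h1 hn hne
  rcases lt_or_gt_of_ne hne with hlt | hgt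
  · refine bsObj_lt_of_const_left _ a1 h1 hlt (by omega) (fun l hl => if_pos hl) (ne_of_gt ?_)
    refine sum_pos' (fun l _ => ?_) ⟨n, mem_Icc.2 ⟨by omega, le_rfl⟩, ?_⟩
    · unfold threeGroup
      split_ifs <;> linarith
    · rw [threeGroup, if_neg (by omega), if_neg (by omega)]
      linarith
  · rcases lt_or_ge κ t2 with hκ | hκ
    · refine bsObj_lt_of_const_between _ a2 ht1 hgt hκ h2n (fun l hl hl' => ?_) hS
      rw [threeGroup, if_neg (by omega), if_pos hl']
    · refine hS.trans_le (bsObj_le_of_const_right _ a3 (by omega) hκ hn fun l hl => ?_)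
      rw [threeGroup, if_neg (by omega), if_neg (by omega)]
end

section
/- Let ι = {(i,j) : 1 ≤ i,j ≤ n, i ≠ j} and let G : ℝ × ℝ → ℝ be strictly increasing in its first argument and strictly decreasing in its second argument. Given vectors W_{i,j} ∈ ℝ^d for (i,j) ∈ ι, define for a parameter (Π, α) ∈ ℝ^d × ℝ the probabilities P_{i,j}(Π, α) = G(⟨W_{i,j}, Π⟩, ⟨W_{j,i}, Π⟩ + α). Suppose (Π₀, α₀) and (Π, α) are two parameter values such that, for all (i,j) ∈ ι and both parameter values, P_{i,j} ∈ (0,1) and P_{i,j} + P_{j,i} < 1, and define the expected log-likelihood EL(Π, α) = Σ_{1 ≤ i < j ≤ n} [ P⁰_{i,j}·log P_{i,j}(Π,α) + P⁰_{j,i}·log P_{j,i}(Π,α) + (1 − P⁰_{i,j} − P⁰_{j,i})·log(1 − P_{i,j}(Π,α) − P_{j,i}(Π,α)) ], where P⁰_{i,j} = P_{i,j}(Π₀, α₀). If there exists (i,j) ∈ ι such that either (⟨W_{i,j}, Π₀ − Π⟩ > 0 and ⟨W_{j,i}, Π₀ − Π⟩ + α₀ − α < 0) or (⟨W_{i,j},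 Π₀ − Π⟩ < 0 and ⟨W_{j,i}, Π₀ − Π⟩ + α₀ − α > 0), then EL(Π, α) < EL(Π₀, α₀). -/
open RealInnerProductSpace Finset

/-- Gibbs' inequality for a single cell. -/
lemma mul_log_le_mul_log_add_sub {p q : ℝ} (hp : 0 < p) (hq : 0 < q) :
    p * Real.log q ≤ p * Real.log p + (q - p) := by
  have h := mul_le_mul_of_nonneg_left (Real.log_le_sub_one_of_pos (div_pos hq hp)) hp.le
  rw [Real.log_div hq.ne' hp.ne', mul_sub, mul_sub, mul_div_cancel₀ q hp.ne'] at h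
  linarith

/-- Strict form of Gibbs' inequality for a single cell. -/
lemma mul_log_lt_mul_log_add_sub {p q : ℝ} (hp : 0 < p) (hq : 0 < q) (hne : q ≠ p) :
    p * Real.log q < p * Real.log p + (q - p) := by
  have hne' : q / p ≠ 1 := fun h => hne ((div_eq_one_iff_eq hp.ne').1 h)
  have h := mul_lt_mul_of_pos_left (Real.log_lt_sub_one_of_pos (div_pos hq hp) hne') hp
  rw [Real.log_div hq.ne' hp.ne', mul_sub, mul_sub, mul_div_cancel₀ q hp.ne'] at h
  linarith

/-- Gibbs' inequality for distributions on three outcomes. -/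
lemma trinomial_loglik_le {p q p' q' : ℝ} (hp : 0 < p) (hq : 0 < q) (hpq : p + q < 1)
    (hp' : 0 < p') (hq' : 0 < q') (hpq' : p' + q' < 1) :
    p * Real.log p' + q * Real.log q' + (1 - p - q) * Real.log (1 - p' - q') ≤
      p * Real.log p + q * Real.log q + (1 - p - q) * Real.log (1 - p - q) := by
  have h₁ := mul_log_le_mul_log_add_sub hp hp'
  have h₂ := mul_log_le_mul_log_add_sub hq hq'
  have h₃ := mul_log_le_mul_log_add_sub (p := 1 - p - q) (q := 1 - p' - q')
    (by linarith) (by linarith)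
  linarith

/-- Strict form of Gibbs' inequality for distributions on three outcomes. -/
lemma trinomial_loglik_lt {p q p' q' : ℝ} (hp : 0 < p) (hq : 0 < q) (hpq : p + q < 1)
    (hp' : 0 < p') (hq' : 0 < q') (hpq' : p' + q' < 1) (hne : p' ≠ p ∨ q' ≠ q) :
    p * Real.log p' + q * Real.log q' + (1 - p - q) * Real.log (1 - p' - q') <
      p * Real.log p + q * Real.log q + (1 - p - q) * Real.log (1 - p - q) := by
  have h₁ := mul_log_le_mul_log_add_sub hp hp'
  have h₂ := mul_log_le_mul_log_add_sub hq hq'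
  have h₃ := mul_log_le_mul_log_add_sub (p := 1 - p - q) (q := 1 - p' - q')
    (by linarith) (by linarith)
  rcases hne with hne | hne
  · linarith [mul_log_lt_mul_log_add_sub hp hp' hne]
  · linarith [mul_log_lt_mul_log_add_sub hq hq' hne]

/-- A function increasing in its first and decreasing in its second argument strictly increases
when the first argument goes up and the second goes down. -/
lemma apply_lt_apply_of_strictMono_of_strictAnti {G : ℝ → ℝ → ℝ}
    (hG1 : ∀ b : ℝ, StrictMono fun a => G a b) (hG2 : ∀ a : ℝ, StrictAnti fun b => G a b)
    {a a' b b' : ℝ} (ha : a < a') (hb : b' < b) : G a b < G a' b' :=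
  (hG1 b ha).trans (hG2 a' hb)

/-- Finite-sample core of Theorem 1(i) (identification): if `G` is strictly
increasing in its first argument and strictly decreasing in its second, the
link probabilities are `P_{i,j}(Π,α) = G(⟪W_{i,j},Π⟫, ⟪W_{j,i},Π⟫ + α)`, all
relevant probabilities lie in `(0,1)` with `P_{i,j} + P_{j,i} < 1`, and the
sign condition of Assumption 4 holds for some dyad, then the expected
log-likelihood at `(Π, α)` is strictly smaller than at `(Pi₀, α₀)`. -/
theorem identification_expected_loglik_strict {n d : ℕ}
    (G : ℝ → ℝ → ℝ)
    (hG1 : ∀ b : ℝ, StrictMono fun a => G a b)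
    (hG2 : ∀ a : ℝ, StrictAnti fun b => G a b)
    (W : Fin n → Fin n → EuclideanSpace ℝ (Fin d))
    (Pi₀ Pi : EuclideanSpace ℝ (Fin d)) (α₀ α : ℝ)
    (Pr : EuclideanSpace ℝ (Fin d) → ℝ → Fin n → Fin n → ℝ)
    (hPr : ∀ Q β i j, Pr Q β i j = G ⟪W i j, Q⟫ (⟪W j i, Q⟫ + β))
    (hP0 : ∀ i j : Fin n, i ≠ j →
      Pr Pi₀ α₀ i j ∈ Set.Ioo (0 : ℝ) 1 ∧ Pr Pi₀ α₀ i j + Pr Pi₀ α₀ j i < 1)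
    (hP : ∀ i j : Fin n, i ≠ j →
      Pr Pi α i j ∈ Set.Ioo (0 : ℝ) 1 ∧ Pr Pi α i j + Pr Pi α j i < 1)
    (EL : EuclideanSpace ℝ (Fin d) → ℝ → ℝ)
    (hEL : ∀ Q β, EL Q β =
      ∑ i : Fin n, ∑ j ∈ Finset.univ.filter (fun j => i < j),
        (Pr Pi₀ α₀ i j * Real.log (Pr Q β i j) +
          Pr Pi₀ α₀ j i * Real.log (Pr Q β j i) +
          (1 - Pr Pi₀ α₀ i j - Pr Pi₀ α₀ j i) *
            Real.log (1 - Pr Q β i j - Pr Q β j i)))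
    (hsupp : ∃ i j : Fin n, i ≠ j ∧
      ((0 < ⟪W i j, Pi₀ - Pi⟫ ∧ ⟪W j i, Pi₀ - Pi⟫ + α₀ - α < 0) ∨
       (⟪W i j, Pi₀ - Pi⟫ < 0 ∧ 0 < ⟪W j i, Pi₀ - Pi⟫ + α₀ - α))) :
    EL Pi α < EL Pi₀ α₀ := by
  obtain ⟨i, j, hij, hsign⟩ := hsupp
  have hne : Pr Pi α i j ≠ Pr Pi₀ α₀ i j := by
    simp only [inner_sub_right] at hsign
    rw [hPr, hPr]
    rcases hsign with ⟨h₁, h₂⟩ | ⟨h₁, h₂⟩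
    · exact (apply_lt_apply_of_strictMono_of_strictAnti hG1 hG2
        (by linarith) (by linarith)).ne
    · exact (apply_lt_apply_of_strictMono_of_strictAnti hG1 hG2
        (by linarith) (by linarith)).ne'
  obtain ⟨k, l, hkl, hne⟩ : ∃ k l : Fin n, k < l ∧
      (Pr Pi α k l ≠ Pr Pi₀ α₀ k l ∨ Pr Pi α l k ≠ Pr Pi₀ α₀ l k) := by
    rcases lt_or_gt_of_ne hij with h | h
    · exact ⟨i, j, h, Or.inl hne⟩
    · exact ⟨j, i, h, Or.inr hne⟩
  have hle : ∀ i, ∀ j ∈ Finset.univ.filter (fun j => i < j), _ := fun i j hj =>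
    have h : i ≠ j := (Finset.mem_filter.1 hj).2.ne
    trinomial_loglik_le (hP0 i j h).1.1 (hP0 j i h.symm).1.1 (hP0 i j h).2
      (hP i j h).1.1 (hP j i h.symm).1.1 (hP i j h).2
  rw [hEL, hEL]
  refine Finset.sum_lt_sum (fun i _ => Finset.sum_le_sum (hle i))
    ⟨k, Finset.mem_univ k, Finset.sum_lt_sum (hle k)
      ⟨l, Finset.mem_filter.2 ⟨Finset.mem_univ l, hkl⟩, ?_⟩⟩
  exact trinomial_loglik_lt (hP0 k l hkl.ne).1.1 (hP0 l k hkl.ne').1.1 (hP0 k l hkl.ne).2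
    (hP k l hkl.ne).1.1 (hP l k hkl.ne').1.1 (hP k l hkl.ne).2 hne
end
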